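/- Let A be a finite set of integers with d(A) = 1, where d(A) is the greatest common divisor of all elements of A - A. Then the number of positive elements of A - A satisfies |(A-A)_+| ≥ min{(|A| + ℓ(A) - 2)/2, (3/2)|A| - 2}, where ℓ(A) = max(A) - min(A) + 1. -/

import Mathlib

open Pointwise

lemma mann_atom {G : Type*} [AddCommGroup G] [Fintype G] [DecidableEq G] (S : Finset G)
    (hS : S ≠ Finset.univ) :
    ∃ (H : AddSubgroup G) (F : Finset G), (∀ x, x ∈ F ↔ x ∈ H) ∧ F + S ≠ Finset.univ ∧
      ∀ X : Finset G, X.Nonempty → X + S ≠ Finset.univ →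
        X.card + (F + S).card ≤ (X + S).card + F.card := by
  classical
  let C : Finset (Finset G) := Finset.univ.filter (fun X => X.Nonempty ∧ X + S ≠ Finset.univ)
  have hC : ∀ X, X ∈ C ↔ X.Nonempty ∧ X + S ≠ Finset.univ := by intro X; simp [C]
  have hCne : C.Nonempty := ⟨{0}, by
    rw [hC]
    refine ⟨Finset.singleton_nonempty 0, ?_⟩
    rwa [Finset.singleton_zero, zero_add]⟩
  obtain ⟨X0, hX0, hmin⟩ := C.exists_min_image
    (fun X => ((X + S).card : ℤ) - X.card) hCne
  set κ : ℤ := ((X0 + S).card : ℤ) - X0.card with hκ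
  let C' := C.filter (fun X => ((X + S).card : ℤ) - X.card = κ)
  have hC'ne : C'.Nonempty := ⟨X0, by simp [C', hX0, hκ]⟩
  obtain ⟨X1, hX1, hmin1⟩ := C'.exists_min_image (fun X => X.card) hC'ne
  have hC' : ∀ X, X ∈ C' ↔ X ∈ C ∧ ((X + S).card : ℤ) - X.card = κ := by
    intro X; simp [C']
  have hv : ∀ (g : G) (X : Finset G), (g +ᵥ X) + S = g +ᵥ (X + S) := by
    intro g X; exact vadd_add_assoc g X S
  have hvC : ∀ (g : G) (X : Finset G), X ∈ C → g +ᵥ X ∈ C := by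
    intro g X hX
    rw [hC] at hX ⊢
    refine ⟨by simpa using hX.1, ?_⟩
    rw [hv]
    intro h
    apply hX.2
    rw [← Finset.card_eq_iff_eq_univ] at h ⊢
    simpa using h
  have hvC' : ∀ (g : G) (X : Finset G), X ∈ C' → g +ᵥ X ∈ C' := by
    intro g X hX
    rw [hC'] at hX ⊢
    refine ⟨hvC g X hX.1, ?_⟩
    rw [hv]; simpa using hX.2
  obtain ⟨x0, hx0⟩ := ((hC X1).1 ((hC' X1).1 hX1).1).1
  set X := (-x0) +ᵥ X1 with hXdef
  have hXC' : X ∈ C' := hvC' _ _ hX1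
  have hXmin : ∀ Y ∈ C', X.card ≤ Y.card := by
    intro Y hY; simpa [hXdef] using hmin1 Y hY
  have h0X : (0 : G) ∈ X := by
    rw [hXdef, Finset.mem_vadd_finset]; exact ⟨x0, hx0, by simp⟩
  have hXC := ((hC' X).1 hXC').1
  have hXκ := ((hC' X).1 hXC').2
  have hXS := ((hC X).1 hXC).2
  -- complementary fragment
  have hbig : (2 * X.card : ℤ) + κ ≤ Fintype.card G := by
    let Z : Finset G := -((X + S)ᶜ)
    have hZne : Z.Nonempty := by
      rw [Finset.nonempty_iff_ne_empty]
      intro h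
      apply hXS
      have : (X + S)ᶜ = ∅ := by simpa [Z] using h
      simpa using this
    have hZsub : Z + S ⊆ (-X)ᶜ := by
      intro w hw
      rw [Finset.mem_add] at hw
      obtain ⟨z, hz, s, hs, rfl⟩ := hw
      rw [Finset.mem_compl]
      intro hmem
      rw [Finset.mem_neg'] at hmem hz
      rw [Finset.mem_compl] at hz
      apply hz
      rw [Finset.mem_add]
      exact ⟨_, hmem, s, hs, by abel⟩
    have hZC : Z ∈ C := by
      rw [hC]
      refine ⟨hZne, ?_⟩
      intro h
      have : (0 : G) ∈ (-X)ᶜ := hZsub (by rw [h]; simp)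
      simp [h0X] at this
    have h1 := hmin Z hZC
    have h2 := Finset.card_le_card hZsub
    have h3 : (-X)ᶜ.card + X.card = Fintype.card G := by
      rw [← Finset.card_neg X]; exact Finset.card_compl_add_card (-X)
    have h4 : Z.card + (X + S).card = Fintype.card G := by
      have := Finset.card_compl_add_card (X + S)
      simpa [Z] using this
    have hZκ : ((Z + S).card : ℤ) - Z.card = κ := by
      omega
    have h5 := hXmin Z ((hC' Z).2 ⟨hZC, hZκ⟩)
    omega
  have htrans : ∀ y ∈ X, y +ᵥ X = X := by
    intro y hy
    by_contra hne
    set Y := y +ᵥ X with hY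
    have hYC' : Y ∈ C' := hvC' y X hXC'
    have hYκ := ((hC' Y).1 hYC').2
    have hYc : Y.card = X.card := by simp [hY]
    have hyY : y ∈ Y := by rw [hY, Finset.mem_vadd_finset]; exact ⟨0, h0X, by simp⟩
    have hlt : (X ∩ Y).card < X.card := by
      apply Finset.card_lt_card
      rw [Finset.ssubset_iff_subset_ne]
      refine ⟨Finset.inter_subset_left, ?_⟩
      intro h
      apply hne
      exact (Finset.eq_of_subset_of_card_le (Finset.inter_eq_left.1 h) hYc.le).symm
    have hIC : X ∩ Y ∈ C := by
      rw [hC]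
      refine ⟨⟨y, by simp [hy, hyY]⟩, ?_⟩
      intro h
      apply hXS
      apply Finset.eq_univ_of_forall
      intro z
      have : z ∈ X ∩ Y + S := by rw [h]; simp
      exact Finset.add_subset_add_right Finset.inter_subset_left this
    have h1 : κ < ((X ∩ Y + S).card : ℤ) - (X ∩ Y).card := by
      refine lt_of_le_of_ne (hmin _ hIC) ?_
      intro h
      have := hXmin _ ((hC' _).2 ⟨hIC, h.symm⟩)
      omega
    have hc := Finset.card_union_add_card_inter X Y
    have hI0 : 0 < (X ∩ Y).card := Finset.card_pos.2 ⟨y, by simp [hy, hyY]⟩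
    have h2 : κ ≤ ((X ∪ Y + S).card : ℤ) - (X ∪ Y).card := by
      by_cases hU : X ∪ Y + S = Finset.univ
      · rw [hU, Finset.card_univ]
        omega
      · exact hmin _ ((hC _).2 ⟨⟨y, by simp [hy]⟩, hU⟩)
    have h3 := Finset.card_union_add_card_inter (X + S) (Y + S)
    rw [← Finset.union_add] at h3
    have h4 : (X ∩ Y + S).card ≤ ((X + S) ∩ (Y + S)).card :=
      Finset.card_le_card Finset.inter_add_subset
    omega
  let H : AddSubgroup G :=
    { carrier := X
      zero_mem' := h0X
      add_mem' := by
        intro a b ha hb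
        have : a +ᵥ b ∈ a +ᵥ X := Finset.vadd_mem_vadd_finset hb
        rw [htrans a ha] at this
        exact this
      neg_mem' := by
        intro a ha
        have : (0 : G) ∈ a +ᵥ X := by rw [htrans a ha]; exact h0X
        rw [Finset.mem_vadd_finset] at this
        obtain ⟨b, hb, hab⟩ := this
        have : -a = b := by rw [vadd_eq_add] at hab; exact neg_eq_of_add_eq_zero_right hab
        change -a ∈ X
        rw [this]; exact hb }
  refine ⟨H, X, fun x => Iff.rfl, hXS, ?_⟩
  intro Y hY hYS
  have := hmin Y ((hC Y).2 ⟨hY, hYS⟩)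
  omega

lemma mann_quot {G : Type*} [AddCommGroup G] [Fintype G] [DecidableEq G] (S : Finset G)
    (hS : S ≠ Finset.univ) :
    ∃ (H : AddSubgroup G) (_ : DecidableEq (G ⧸ H)) (h : ℕ), 0 < h ∧
      (∀ T : Finset (G ⧸ H), (Finset.univ.filter (fun x : G => (x : G ⧸ H) ∈ T)).card = T.card * h) ∧
      (∃ x : G, (x : G ⧸ H) ∉ S.image (fun x : G => (x : G ⧸ H))) ∧
      ∀ X : Finset G, X.Nonempty → X + S ≠ Finset.univ →
        X.card + (S.image (fun x : G => (x : G ⧸ H))).card * h ≤ (X + S).card + h := by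
  classical
  obtain ⟨H, F, hF, hne, hX⟩ := mann_atom S hS
  have key : ∀ T : Finset (G ⧸ H),
      (Finset.univ.filter (fun x : G => (x : G ⧸ H) ∈ T)).card = T.card * F.card := by
    intro T
    have hm : Set.MapsTo (fun x : G => (x : G ⧸ H))
        (Finset.univ.filter (fun x : G => (x : G ⧸ H) ∈ T) : Finset G) T := by
      intro x hx; simpa using hx
    rw [Finset.card_eq_sum_card_fiberwise hm, Finset.sum_const_nat]
    intro q hq
    obtain ⟨g, rfl⟩ := QuotientAddGroup.mk_surjective q
    rw [← Finset.card_vadd_finset g F]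
    congr 1
    ext x
    rw [Finset.mem_vadd_finset]
    simp only [Finset.mem_filter, Finset.mem_univ, true_and]
    constructor
    · rintro ⟨-, h⟩
      refine ⟨-g + x, ?_, by simp⟩
      rw [hF]; exact QuotientAddGroup.eq.1 h.symm
    · rintro ⟨y, hy, rfl⟩
      have : ((g +ᵥ y : G) : G ⧸ H) = (g : G ⧸ H) := by
        symm; rw [QuotientAddGroup.eq]; simpa using (hF y).1 hy
      exact ⟨by rw [this]; exact hq, this⟩
  have hFS : F + S = Finset.univ.filter
      (fun x : G => (x : G ⧸ H) ∈ S.image (fun x : G => (x : G ⧸ H))) := by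
    ext x
    simp only [Finset.mem_add, Finset.mem_filter, Finset.mem_univ, true_and, Finset.mem_image]
    constructor
    · rintro ⟨f, hf, s, hs, rfl⟩
      refine ⟨s, hs, ?_⟩
      rw [QuotientAddGroup.eq]
      have := (hF f).1 hf
      simpa [add_comm f s] using this
    · rintro ⟨s, hs, h⟩
      refine ⟨-s + x, ?_, s, hs, by abel⟩
      rw [hF]; exact QuotientAddGroup.eq.1 h
  refine ⟨H, inferInstance, F.card, Finset.card_pos.2 ⟨0, (hF 0).2 H.zero_mem⟩, key, ?_, ?_⟩
  · by_contra! hall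
    apply hne
    rw [hFS]
    exact Finset.filter_true_of_mem (fun x _ => hall x)
  · intro X h1 h2
    have := hX X h1 h2
    rwa [hFS, key] at this

lemma fiber_count {Q : Type*} [AddCommGroup Q] [DecidableEq Q] (φ : ℤ →+ Q) (A : Finset ℤ)
    (i0 : Q) (hi0 : i0 ∈ A.image φ) (w : ℤ)
    (hw : ∀ i ∈ A.image φ, ∀ j ∈ A.image φ, i ≠ j →
      w ≤ ((A.filter (fun x => φ x = i)).card : ℤ) + (A.filter (fun x => φ x = j)).card - 1)
    (hw0 : 0 ≤ w)
    (hT : 2 * ((A.image φ).card : ℤ) - 1 ≤ ((A.image φ - A.image φ).card : ℤ)) :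
    (A.card : ℤ) + (A.image φ).card * (((A.filter (fun x => φ x = i0)).card : ℤ) - 1)
      + ((A.image φ).card - 1) * w ≤ ((A - A).card : ℤ) := by
  set S := A.image φ with hS
  set a : Q → ℤ := fun i => ((A.filter (fun x => φ x = i)).card : ℤ) with ha
  set D : Q → ℤ := fun c => (((A - A).filter (fun x => φ x = c)).card : ℤ) with hD
  have hfib : ∀ i ∈ S, ∀ j ∈ S, a i + a j - 1 ≤ D (i - j) := by
    intro i hi j hj
    have hne : ∀ i ∈ S, (A.filter (fun x => φ x = i)).Nonempty := by
      intro i hi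
      obtain ⟨x, hx, rfl⟩ := Finset.mem_image.1 hi
      exact ⟨x, by simp [hx]⟩
    have h1 := cauchy_davenport_add_of_linearOrder_isCancelAdd (hne i hi) ((hne j hj).neg)
    rw [Finset.card_neg] at h1
    have h2 : (A.filter (fun x => φ x = i)) + -(A.filter (fun x => φ x = j)) ⊆
        (A - A).filter (fun x => φ x = i - j) := by
      intro x hx
      obtain ⟨y, hy, z, hz, rfl⟩ := Finset.mem_add.1 hx
      rw [Finset.mem_neg'] at hz
      simp only [Finset.mem_filter] at hy hz ⊢
      refine ⟨Finset.mem_sub.2 ⟨y, hy.1, -z, hz.1, by ring⟩, ?_⟩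
      rw [map_add, hy.2, ← hz.2, map_neg]; abel
    have h3 := Finset.card_le_card h2
    simp only [ha, hD]
    omega
  have hsum : ((A - A).card : ℤ) = ∑ c ∈ S - S, D c := by
    have hm : Set.MapsTo φ (A - A : Finset ℤ) (S - S : Finset Q) := by
      intro x hx
      obtain ⟨y, hy, z, hz, rfl⟩ := Finset.mem_sub.1 (Finset.mem_coe.1 hx)
      rw [map_sub]
      exact Finset.mem_coe.2 (Finset.sub_mem_sub (Finset.mem_image_of_mem _ hy)
        (Finset.mem_image_of_mem _ hz))
    rw [Finset.card_eq_sum_card_fiberwise hm]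
    push_cast; rfl
  have hsumA : (A.card : ℤ) = ∑ i ∈ S, a i := by
    have hm : Set.MapsTo φ A S := by
      intro x hx
      exact Finset.mem_coe.2 (Finset.mem_image_of_mem _ hx)
    rw [Finset.card_eq_sum_card_fiberwise hm]
    push_cast; rfl
  set S1 := S.image (fun i => i - i0) with hS1
  have hS1c : S1.card = S.card := Finset.card_image_of_injective _ (sub_left_injective)
  have hS1sub : S1 ⊆ S - S := by
    intro x hx
    obtain ⟨i, hi, rfl⟩ := Finset.mem_image.1 hx
    exact Finset.sub_mem_sub hi hi0
  have hs1 : ∑ c ∈ S1, D c ≥ A.card + S.card * (a i0 - 1) := by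
    rw [hS1, Finset.sum_image (fun x _ y _ h => sub_left_injective h), hsumA,
      ← nsmul_eq_mul, ← Finset.sum_const, ← Finset.sum_add_distrib]
    apply Finset.sum_le_sum
    intro i hi
    have := hfib i hi i0 hi0
    linarith
  have hs2 : ((S - S) \ S1).card * w ≤ ∑ c ∈ (S - S) \ S1, D c := by
    rw [← nsmul_eq_mul]
    apply Finset.card_nsmul_le_sum
    intro c hc
    rw [Finset.mem_sdiff] at hc
    obtain ⟨i, hi, j, hj, rfl⟩ := Finset.mem_sub.1 hc.1
    refine le_trans (hw i hi j hj ?_) (hfib i hi j hj)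
    rintro rfl
    apply hc.2
    rw [hS1, Finset.mem_image]
    exact ⟨i0, hi0, by simp⟩
  have hc := Finset.card_sdiff_add_card_eq_card hS1sub
  have hc2 : (S.card : ℤ) - 1 ≤ ((S - S) \ S1).card := by omega
  have := mul_le_mul_of_nonneg_right hc2 hw0
  have h := Finset.sum_sdiff (f := D) hS1sub
  rw [hsum]
  simp only [ha] at *
  linarith

lemma lift_count (A : Finset ℤ) (l : ℕ) (hl : 0 < l) (h0 : (0 : ℤ) ∈ A) (hlA : (l : ℤ) ∈ A)
    (hA : ∀ a ∈ A, 0 ≤ a ∧ a ≤ l) :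
    A.card + (A.image (fun x : ℤ => (x : ZMod l)) - A.image (fun x : ℤ => (x : ZMod l))).card
      ≤ (A - A).card := by
  set B := A.image (fun x : ℤ => (x : ZMod l)) with hB
  set E := insert (-(l : ℤ)) (A.erase 0) with hE
  have hEc : E.card = A.card := by
    rw [hE, Finset.card_insert_of_notMem, Finset.card_erase_add_one h0]
    intro h
    have := hA _ (Finset.mem_of_mem_erase h)
    omega
  have hEs : E ⊆ A - A := by
    intro x hx
    rw [hE, Finset.mem_insert] at hx
    rcases hx with rfl | hx
    · exact Finset.mem_sub.2 ⟨0, h0, l, hlA, by simp⟩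
    · exact Finset.mem_sub.2 ⟨x, Finset.mem_of_mem_erase hx, 0, h0, by simp⟩
  have hsub : B - B ⊆ ((A - A) \ E).image (fun x : ℤ => (x : ZMod l)) := by
    intro c hc
    obtain ⟨x, hx, y, hy, rfl⟩ := Finset.mem_sub.1 hc
    obtain ⟨a, ha, rfl⟩ := Finset.mem_image.1 hx
    obtain ⟨b, hb, rfl⟩ := Finset.mem_image.1 hy
    rw [Finset.mem_image]
    by_cases h1 : a - b ∈ E
    · rw [hE, Finset.mem_insert] at h1
      rcases h1 with h1 | h1
      · refine ⟨0, ?_, ?_⟩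
        · rw [Finset.mem_sdiff]
          refine ⟨Finset.mem_sub.2 ⟨0, h0, 0, h0, by simp⟩, ?_⟩
          rw [hE]
          simp
          omega
        · rw [← Int.cast_sub, h1]; simp
      · have h2 := Finset.mem_of_mem_erase h1
        have h3 := Finset.ne_of_mem_erase h1
        have h4 := hA _ h2
        refine ⟨a - b - l, ?_, by simp⟩
        rw [Finset.mem_sdiff]
        refine ⟨Finset.mem_sub.2 ⟨_, h2, l, hlA, by simp⟩, ?_⟩
        rw [hE, Finset.mem_insert, Finset.mem_erase]
        rintro (h | ⟨h, h'⟩)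
        · omega
        · have := hA _ h'
          omega
    · exact ⟨a - b, by
        rw [Finset.mem_sdiff]
        exact ⟨Finset.sub_mem_sub ha hb, h1⟩, by simp⟩
  have h1 := (Finset.card_le_card hsub).trans Finset.card_image_le
  have h2 := Finset.card_sdiff_add_card_eq_card hEs
  omega

lemma final_arith (u h r y : ℤ) (hu : 3 ≤ u) (hr : 0 ≤ r) (hh : 2 * r + 2 ≤ h)
    (hy : 2 * h - r ≤ 2 * y ∨ (1 ≤ r ∧ 2 * h - r - 1 ≤ 2 * y)) :
    3 * (u * h - r) ≤ (u * h - r + 1) + u * y + (u - 1) * (2 * h - r - 1) := by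
  obtain ⟨v, rfl⟩ : ∃ v, u = v + 3 := ⟨u - 3, by ring⟩
  obtain ⟨g, rfl⟩ : ∃ g, h = g + (2 * r + 2) := ⟨h - (2 * r + 2), by ring⟩
  have hv : 0 ≤ v := by linarith
  have hg : 0 ≤ g := by linarith
  have := mul_nonneg hv hg
  have := mul_nonneg hv hr
  rcases hy with hy | ⟨h1, hy⟩
  · nlinarith [mul_le_mul_of_nonneg_left hy hv]
  · nlinarith [mul_le_mul_of_nonneg_left hy hv]

lemma core (A : Finset ℤ) (l : ℕ) (hl : 0 < l) (h0 : (0 : ℤ) ∈ A) (hlA : (l : ℤ) ∈ A)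
    (hA : ∀ a ∈ A, 0 ≤ a ∧ a ≤ l) (hg : ∀ g : ℤ, (∀ a ∈ A, g ∣ a) → g ∣ 1) :
    A.card + l ≤ (A - A).card ∨ 3 * A.card ≤ (A - A).card + 3 := by
  haveI : NeZero l := ⟨hl.ne'⟩
  have hlift := lift_count A l hl h0 hlA hA
  set B := A.image (fun x : ℤ => (x : ZMod l)) with hB
  have h0B : (0 : ZMod l) ∈ B := by
    rw [hB, Finset.mem_image]; exact ⟨0, h0, by simp⟩
  have hBc : B.card + 1 = A.card := by
    have h1 : B = (A.erase l).image (fun x : ℤ => (x : ZMod l)) := by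
      ext x
      rw [hB, Finset.mem_image, Finset.mem_image]
      constructor
      · rintro ⟨a, ha, rfl⟩
        by_cases hal : a = l
        · refine ⟨0, ?_, by simp [hal]⟩
          rw [Finset.mem_erase]
          exact ⟨by omega, h0⟩
        · exact ⟨a, Finset.mem_erase.2 ⟨hal, ha⟩, rfl⟩
      · rintro ⟨a, ha, rfl⟩
        exact ⟨a, Finset.mem_of_mem_erase ha, rfl⟩
    rw [h1, Finset.card_image_of_injOn, Finset.card_erase_add_one hlA]
    intro x hx y hy hxy
    have hx' := Finset.mem_erase.1 (Finset.mem_coe.1 hx)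
    have hy' := Finset.mem_erase.1 (Finset.mem_coe.1 hy)
    have hx2 := hA _ hx'.2
    have hy2 := hA _ hy'.2
    have h3 : x % l = y % l := (ZMod.intCast_eq_intCast_iff' x y l).1 hxy
    rwa [Int.emod_eq_of_lt hx2.1 (by omega), Int.emod_eq_of_lt hy2.1 (by omega)] at h3
  by_cases hBB : B - B = Finset.univ
  · left
    rw [hBB, Finset.card_univ, ZMod.card] at hlift
    exact hlift
  have hBu : B ≠ Finset.univ := by
    intro h
    apply hBB
    apply Finset.eq_univ_of_forall
    intro x
    exact Finset.mem_sub.2 ⟨x, by rw [h]; simp, 0, h0B, by simp⟩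
  right
  obtain ⟨H, hdec, h, hh, key, ⟨x0, hx0⟩, hX⟩ := mann_quot B hBu
  let mk : ZMod l →+ (ZMod l ⧸ H) := QuotientAddGroup.mk' H
  have hmk : ∀ x : ZMod l, (x : ZMod l ⧸ H) = mk x := fun _ => rfl
  simp only [hmk] at key hx0 hX
  let φ : ℤ →+ (ZMod l ⧸ H) := mk.comp (Int.castAddHom (ZMod l))
  have hφ : ∀ x : ℤ, φ x = mk (x : ZMod l) := fun _ => rfl
  set S := B.image (fun x => mk x) with hS
  have hSA : A.image φ = S := by
    rw [hS, hB, Finset.image_image]; rfl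
  have h0S : (0 : ZMod l ⧸ H) ∈ S := Finset.mem_image.2 ⟨0, h0B, map_zero mk⟩
  let b : ZMod l ⧸ H → ℕ := fun q => (B.filter (fun x => mk x = q)).card
  let a : ZMod l ⧸ H → ℕ := fun q => (A.filter (fun x => φ x = q)).card
  have hbdef : ∀ q, b q = (B.filter (fun x => mk x = q)).card := fun _ => rfl
  have hadef : ∀ q, a q = (A.filter (fun x => φ x = q)).card := fun _ => rfl
  have hfibq : ∀ q, (Finset.univ.filter (fun x : ZMod l => mk x = q)).card = h := by
    intro q
    have := key {q}
    simpa using this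
  have hbh : ∀ q, b q ≤ h := by
    intro q
    rw [← hfibq q, hbdef]
    exact Finset.card_le_card (Finset.filter_subset_filter _ (Finset.subset_univ _))
  have hsumb : B.card = ∑ q ∈ S, b q := Finset.card_eq_sum_card_image _ _
  have hsuma : A.card = ∑ q ∈ S, a q := by
    rw [← hSA]; exact Finset.card_eq_sum_card_image _ _
  have hab : ∀ q, b q ≤ a q := by
    intro q
    rw [hbdef, hadef]
    refine le_trans (Finset.card_le_card ?_) (Finset.card_image_le (f := fun x : ℤ => (x : ZMod l)))
    intro x hx
    rw [Finset.mem_filter] at hx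
    obtain ⟨y, hy, rfl⟩ := Finset.mem_image.1 hx.1
    exact Finset.mem_image.2 ⟨y, by rw [Finset.mem_filter]; exact ⟨hy, hx.2⟩, rfl⟩
  have hφl : φ (l : ℤ) = 0 := by rw [hφ]; simp
  have hab0 : b 0 + 1 ≤ a 0 := by
    have hlm : (l : ℤ) ∈ A.filter (fun x => φ x = 0) := by
      rw [Finset.mem_filter]; exact ⟨hlA, hφl⟩
    rw [hbdef, hadef, ← Finset.card_erase_add_one hlm]
    refine Nat.succ_le_succ (le_trans (Finset.card_le_card ?_)
      (Finset.card_image_le (f := fun x : ℤ => (x : ZMod l))))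
    intro x hx
    rw [Finset.mem_filter] at hx
    obtain ⟨y, hy, rfl⟩ := Finset.mem_image.1 hx.1
    rw [Finset.mem_image]
    by_cases hyl : y = l
    · refine ⟨0, ?_, by simp [hyl]⟩
      rw [Finset.mem_erase, Finset.mem_filter]
      exact ⟨by omega, h0, map_zero φ⟩
    · refine ⟨y, ?_, rfl⟩
      rw [Finset.mem_erase, Finset.mem_filter]
      exact ⟨hyl, hy, hx.2⟩
  -- bound of Mann type
  have hm1 : B.card + S.card * h ≤ (B - B).card + h := by
    have h1 : -B + B = B - B := by rw [sub_eq_add_neg, add_comm]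
    have := hX (-B) (Finset.Nonempty.neg ⟨0, h0B⟩) (by rw [h1]; exact hBB)
    rwa [h1, Finset.card_neg] at this
  by_cases hrh : B.card + h ≤ S.card * h + 1
  · omega
  push Not at hrh
  -- at least two cosets
  have hne : ∃ i ∈ S, i ≠ 0 := by
    by_contra! hall
    have hker : ∀ x ∈ A, φ x = 0 := by
      intro x hx
      exact hall _ (by rw [← hSA]; exact Finset.mem_image_of_mem _ hx)
    obtain ⟨g, hgk⟩ := Int.subgroup_cyclic φ.ker
    rw [← AddSubgroup.zmultiples_eq_closure] at hgk
    have h1 : g ∣ 1 := by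
      apply hg
      intro x hx
      have : x ∈ φ.ker := hker x hx
      rw [hgk] at this
      exact Int.mem_zmultiples_iff.1 this
    have hz : ∀ z : ℤ, φ z = 0 := by
      intro z
      have : z ∈ φ.ker := by
        rw [hgk, Int.mem_zmultiples_iff]; exact h1.trans (one_dvd z)
      exact this
    apply hx0
    obtain ⟨z, rfl⟩ := ZMod.intCast_surjective x0
    rw [← hφ, hz]
    exact h0S
  obtain ⟨i1, hi1, hi10⟩ := hne
  have hu2 : 2 ≤ S.card := Finset.one_lt_card.2 ⟨i1, hi1, 0, h0S, hi10⟩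
  have hpair : ∀ i ∈ S, ∀ j ∈ S, i ≠ j → 2 * h + B.card ≤ b i + b j + S.card * h := by
    intro i hi j hj hij
    have hsub : ({i, j} : Finset _) ⊆ S := by
      intro x hx
      simp only [Finset.mem_insert, Finset.mem_singleton] at hx
      rcases hx with rfl | rfl <;> assumption
    have h1 := Finset.sum_sdiff (f := b) hsub
    rw [Finset.sum_pair hij, ← hsumb] at h1
    have h2 := Finset.card_sdiff_add_card_eq_card hsub
    rw [Finset.card_pair hij] at h2
    have h3 : ∑ q ∈ S \ {i, j}, b q ≤ (S \ {i, j}).card * h := by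
      rw [← smul_eq_mul]
      exact Finset.sum_le_card_nsmul _ _ _ (fun q _ => hbh q)
    rw [← h2, add_mul]
    omega
  have hmeet : ∀ x : ZMod l, ∀ i j, mk x = i - j → h < b i + b j → x ∈ B - B := by
    intro x i j hx hlt
    set U := x +ᵥ (B.filter (fun y => mk y = j)) with hU
    set V := B.filter (fun y => mk y = i) with hV
    have hUc : U.card = b j := Finset.card_vadd_finset _ _
    have hUV : U ∪ V ⊆ Finset.univ.filter (fun y : ZMod l => mk y = i) := by
      apply Finset.union_subset
      · intro z hz
        rw [hU, Finset.mem_vadd_finset] at hz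
        obtain ⟨y, hy, rfl⟩ := hz
        rw [Finset.mem_filter] at hy ⊢
        refine ⟨Finset.mem_univ _, ?_⟩
        rw [vadd_eq_add, map_add, hx, hy.2, sub_add_cancel]
      · exact Finset.filter_subset_filter _ (Finset.subset_univ _)
    have h1 := Finset.card_le_card hUV
    rw [hfibq] at h1
    have h2 := Finset.card_union_add_card_inter U V
    have h3 : V.card = b i := rfl
    have h4 : 0 < (U ∩ V).card := by omega
    obtain ⟨z, hz⟩ := Finset.card_pos.1 h4
    rw [Finset.mem_inter, hU, Finset.mem_vadd_finset] at hz
    obtain ⟨⟨y, hy, rfl⟩, hzV⟩ := hz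
    exact Finset.mem_sub.2 ⟨_, (Finset.mem_filter.1 hzV).1, y, (Finset.mem_filter.1 hy).1, by simp⟩
  have hfull : ∀ x : ZMod l, mk x ∈ S - S → x ∈ B - B := by
    intro x hx
    obtain ⟨i, hi, j, hj, hij⟩ := Finset.mem_sub.1 hx
    by_cases hne : i = j
    · have hx' : mk x = 0 := by rw [← hij, hne, sub_self]
      have := hpair i1 hi1 0 h0S hi10
      by_cases hb0 : h < b 0 + b 0
      · exact hmeet x 0 0 (by rw [hx', sub_self]) hb0
      · exact hmeet x i1 i1 (by rw [hx', sub_self]) (by omega)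
    · have := hpair i hi j hj hne
      exact hmeet x i j hij.symm (by omega)
  have hBBc : (S - S).card * h ≤ (B - B).card := by
    rw [← key]
    apply Finset.card_le_card
    intro x hx
    exact hfull x (Finset.mem_filter.1 hx).2
  have hT : 2 * S.card ≤ (S - S).card + 1 := by
    set X := Finset.univ.filter (fun x : ZMod l => mk x ∈ -S) with hXd
    have hXB : X + B = Finset.univ.filter (fun x : ZMod l => mk x ∈ S - S) := by
      ext x
      rw [Finset.mem_add, Finset.mem_filter]
      constructor
      · rintro ⟨y, hy, z, hz, rfl⟩
        refine ⟨Finset.mem_univ _, ?_⟩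
        have hy2 := (Finset.mem_filter.1 hy).2
        rw [Finset.mem_neg'] at hy2
        exact Finset.mem_sub.2 ⟨mk z, Finset.mem_image_of_mem _ hz, _, hy2, by rw [map_add]; abel⟩
      · rintro ⟨-, hx⟩
        obtain ⟨i, hi, j, hj, hij⟩ := Finset.mem_sub.1 hx
        obtain ⟨z, hz, rfl⟩ := Finset.mem_image.1 hi
        refine ⟨x - z, ?_, z, hz, by simp⟩
        rw [hXd, Finset.mem_filter]
        refine ⟨Finset.mem_univ _, ?_⟩
        rw [Finset.mem_neg', map_sub, ← hij]
        simpa using hj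
    have h1 := hX X ⟨0, by rw [hXd, Finset.mem_filter]; exact ⟨Finset.mem_univ _, by rw [Finset.mem_neg', map_zero, neg_zero]; exact h0S⟩⟩ (by
      intro hu
      apply hBB
      apply Finset.eq_univ_of_forall
      intro x
      apply hfull
      have : x ∈ X + B := by rw [hu]; simp
      rw [hXB] at this
      exact (Finset.mem_filter.1 this).2)
    rw [hXB, hXd, key, key, Finset.card_neg] at h1
    have h2 : (2 * S.card) * h ≤ ((S - S).card + 1) * h := by
      rw [two_mul, add_mul, add_mul, one_mul]; exact h1
    exact Nat.le_of_mul_le_mul_right h2 hh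
  have hBB2 : 2 * (S.card * h) ≤ (B - B).card + h := by
    have := Nat.mul_le_mul_right h hT
    rw [add_mul, mul_assoc] at this
    omega
  have hBle : B.card ≤ S.card * h := by
    rw [hsumb, ← smul_eq_mul]
    exact Finset.sum_le_card_nsmul _ _ _ (fun q _ => hbh q)
  by_cases hcase : h + 2 * B.card ≤ 2 * (S.card * h) + 1
  · omega
  push Not at hcase
  have hfc := fiber_count φ A
  rw [hSA] at hfc
  simp only [← hadef] at hfc
  have hT' : 2 * (S.card : ℤ) - 1 ≤ ((S - S).card : ℤ) := by omega
  by_cases hu3 : S.card = 2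
  · obtain ⟨i, j, hij, hSij⟩ := Finset.card_eq_two.1 hu3
    rw [hSij, Finset.sum_pair hij] at hsuma
    have hsym : ∀ i' ∈ S, ∀ j' ∈ S, i' ≠ j' → (A.card : ℤ) - 1 ≤ (a i' : ℤ) + a j' - 1 := by
      intro i' hi' j' hj' hne
      rw [hSij] at hi' hj'
      simp only [Finset.mem_insert, Finset.mem_singleton] at hi' hj'
      rcases hi' with rfl | rfl <;> rcases hj' with rfl | rfl <;> first | omega | exact absurd rfl hne
    have hA1 : (0 : ℤ) ≤ (A.card : ℤ) - 1 := by omega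
    have hi := hfc i (by rw [hSij]; simp) _ hsym hA1 hT'
    have hj := hfc j (by rw [hSij]; simp) _ hsym hA1 hT'
    rw [hu3] at hi hj
    push_cast at hi hj
    omega
  · have hu : (3 : ℤ) ≤ S.card := by omega
    obtain ⟨r, hr⟩ : ∃ r : ℤ, r = (S.card : ℤ) * h - B.card := ⟨_, rfl⟩
    zify at hBle hcase hBc
    have hr0 : 0 ≤ r := by linarith
    have hrh2 : 2 * r + 2 ≤ h := by linarith
    have hpz : ∀ i ∈ S, ∀ j ∈ S, i ≠ j → 2 * (h : ℤ) - r ≤ b i + b j := by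
      intro i hi j hj hij
      have := hpair i hi j hj hij
      zify at this
      linarith
    have hw : ∀ i ∈ S, ∀ j ∈ S, i ≠ j → 2 * (h : ℤ) - r - 1 ≤ (a i : ℤ) + a j - 1 := by
      intro i hi j hj hij
      have h1 := hpz i hi j hj hij
      have h2 := hab i
      have h3 := hab j
      omega
    have hw0 : 0 ≤ 2 * (h : ℤ) - r - 1 := by linarith
    have hfin : ∀ i ∈ S, (2 * (h : ℤ) - r ≤ 2 * ((a i : ℤ) - 1) ∨
        (1 ≤ r ∧ 2 * (h : ℤ) - r - 1 ≤ 2 * ((a i : ℤ) - 1))) → 3 * A.card ≤ (A - A).card + 3 := by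
      intro i hi hor
      have h1 := hfc i hi _ hw hw0 hT'
      have h2 := final_arith S.card h r ((a i : ℤ) - 1) hu hr0 hrh2 hor
      zify
      have h3 : (A.card : ℤ) = S.card * h - r + 1 := by linarith
      rw [h3] at h1 ⊢
      linarith
    have hpp := hpz i1 hi1 0 h0S hi10
    have h1 := hab i1
    have h2 := hbh 0
    have h3 := hbh i1
    by_cases hc : 2 * (h : ℤ) - r ≤ 2 * (b 0 : ℤ)
    · exact hfin 0 h0S (by left; omega)
    · exact hfin i1 hi1 (by right; omega)

theorem lev_smeliansky_diff (A : Finset ℤ) (hA : 2 ≤ A.card)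
    (hd : Finset.gcd (A - A) id = 1) :
    min ((A.card : ℤ) + (A.max' (Finset.card_pos.mp (by omega)) -
          A.min' (Finset.card_pos.mp (by omega)) + 1) - 2)
        (3 * (A.card : ℤ) - 4)
      ≤ 2 * (((A - A).filter (fun x => 0 < x)).card : ℤ) := by
  have hne : A.Nonempty := Finset.card_pos.mp (by omega)
  have hMm : A.min' hne < A.max' hne := Finset.min'_lt_max'_of_card A (by omega)
  have hMmem := A.max'_mem hne
  have hmmem := A.min'_mem hne
  have hle : ∀ a ∈ A, A.min' hne ≤ a ∧ a ≤ A.max' hne :=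
    fun a ha => ⟨A.min'_le a ha, A.le_max' a ha⟩
  generalize A.max' hne = M at *
  generalize A.min' hne = m at *
  set A' := A.image (fun x => x - m) with hA'
  have hc : A'.card = A.card := Finset.card_image_of_injective _ sub_left_injective
  have hmem : ∀ x, x ∈ A' ↔ x + m ∈ A := by
    intro x
    rw [hA', Finset.mem_image]
    constructor
    · rintro ⟨a, ha, rfl⟩; simpa using ha
    · intro h; exact ⟨x + m, h, by ring⟩
  have hAA : A' - A' = A - A := by
    ext x
    rw [Finset.mem_sub, Finset.mem_sub]
    constructor
    · rintro ⟨a, ha, b, hb, rfl⟩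
      exact ⟨_, (hmem a).1 ha, _, (hmem b).1 hb, by ring⟩
    · rintro ⟨a, ha, b, hb, rfl⟩
      exact ⟨a - m, (hmem _).2 (by simpa using ha), b - m, (hmem _).2 (by simpa using hb), by ring⟩
  have hlc : ((M - m).toNat : ℤ) = M - m := Int.toNat_of_nonneg (by omega)
  have hcore := core A' (M - m).toNat (by omega) ((hmem 0).2 (by simpa using hmmem))
    ((hmem _).2 (by rw [hlc]; simpa using hMmem))
    (by
      intro a ha
      have := hle _ ((hmem a).1 ha)
      omega)
    (by
      intro g hg
      rw [← hd]
      apply Finset.dvd_gcd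
      intro x hx
      rw [← hAA] at hx
      obtain ⟨a, ha, b, hb, rfl⟩ := Finset.mem_sub.1 hx
      exact dvd_sub (hg a ha) (hg b hb))
  rw [hc, hAA] at hcore
  have hsplit : (A - A).card = 2 * ((A - A).filter (fun x => 0 < x)).card + 1 := by
    have h1 : A - A = (insert 0 ((A - A).filter (fun x => 0 < x))) ∪
        -((A - A).filter (fun x => 0 < x)) := by
      ext x
      have hneg : -x ∈ A - A ↔ x ∈ A - A := by
        rw [← Finset.mem_neg', neg_sub]
      have h00 : (0 : ℤ) ∈ A - A := Finset.mem_sub.2 ⟨m, hmmem, m, hmmem, by simp⟩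
      rw [Finset.mem_union, Finset.mem_insert, Finset.mem_neg', Finset.mem_filter,
        Finset.mem_filter, hneg]
      constructor
      · intro hx
        rcases lt_trichotomy x 0 with h | h | h
        · right; exact ⟨hx, by omega⟩
        · left; left; exact h
        · left; right; exact ⟨hx, h⟩
      · rintro ((rfl | h) | h)
        · exact h00
        · exact h.1
        · exact h.1
    have hdisj : Disjoint (insert 0 ((A - A).filter (fun x => 0 < x)))
        (-((A - A).filter (fun x => 0 < x))) := by
      rw [Finset.disjoint_left]
      intro x hx hx'
      rw [Finset.mem_neg', Finset.mem_filter] at hx'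
      rw [Finset.mem_insert, Finset.mem_filter] at hx
      rcases hx with hx | hx <;> omega
    have h2 := congrArg Finset.card h1
    rw [Finset.card_union_of_disjoint hdisj, Finset.card_insert_of_notMem (by simp),
      Finset.card_neg] at h2
    omega
  rcases hcore with h | h
  · refine le_trans (min_le_left _ _) ?_
    omega
  · refine le_trans (min_le_right _ _) ?_
    omega
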